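/- arXiv:2008.10502 — 3 statements merged into one kernel-verified Lean document; each statement's English description precedes it below -/
import Mathlib

section
/- Let p > 3 be a prime and let j be an integer with 2 ≤ j ≤ p−1. Let M_p(j) be the set of integers i with 1 ≤ i ≤ (p−1)/2 such that i < {ij}_p < p/2. Then the cardinality of M_p(j) satisfies |M_p(j)| ≡ ((1−j | p) − 1)/2 + (p²−1)/8 (mod 2), where (· | p) is the Legendre symbol. -/
open Finset

/-- Multiplication by a unit permutes the absolute values of the least absolute residues. -/
theorem sum_natAbs_valMinAbs_mul (p : ℕ) [Fact p.Prime] {a : ZMod p} (ha : a ≠ 0) :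
    ∑ i ∈ Ico 1 (p / 2).succ, (a * i).valMinAbs.natAbs = ∑ i ∈ Ico 1 (p / 2).succ, i := by
  have h := congrArg Multiset.sum (ZMod.Ico_map_valMinAbs_natAbs_eq_Ico_map_id p a ha)
  simpa only [Finset.sum, Multiset.map_id'] using h

theorem eight_mul_sum_Ico_add_one (m : ℕ) :
    8 * ∑ i ∈ Ico 1 m.succ, i + 1 = (2 * m + 1) ^ 2 := by
  induction m with
  | zero => simp
  | succ m ih =>
    rw [sum_Ico_succ_top (by omega)]
    linear_combination ih

/-- The parity of the number of conditions `i < {ij}_p < p/2` and `{i(1-j)}_p > p/2` that hold. -/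
theorem indicator_add_indicator_modEq (p : ℕ) [Fact p.Prime] (hp : p ≠ 2) (j i : ℕ)
    (hi : i ∈ Ico 1 (p / 2).succ) :
    (if i < (i * j) % p ∧ 2 * ((i * j) % p) < p then 1 else 0) +
        (if p / 2 < ((1 - j : ZMod p) * i).val then 1 else 0)
      ≡ ((j : ZMod p) * i).valMinAbs.natAbs + i + ((1 - j : ZMod p) * i).valMinAbs.natAbs
        [MOD 2] := by
  have hodd : p % 2 = 1 := (Fact.out : p.Prime).eq_two_or_odd.resolve_left hp
  have hval : ((j : ZMod p) * i).val = (i * j) % p := by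
    rw [← ZMod.val_natCast, Nat.cast_mul, mul_comm]
  have hr : (i * j) % p < p := Nat.mod_lt _ (by omega)
  have hval' : ((((1 - j : ZMod p) * i).val : ℕ) : ℤ) = ((i : ℤ) - ((i * j) % p : ℕ)) % p := by
    rw [← ZMod.val_intCast]
    push_cast [ZMod.natCast_mod]
    congr 2
    ring
  rw [ZMod.valMinAbs_def_pos, ZMod.valMinAbs_def_pos, hval]
  generalize (i * j) % p = r at *
  generalize ((1 - j : ZMod p) * i).val = v at *
  rw [mem_Ico] at hi
  have hv : (v : ℤ) = if r ≤ i then (i : ℤ) - r else i - r + p := by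
    rw [hval']
    split_ifs
    · exact Int.emod_eq_of_lt (by omega) (by omega)
    · rw [← Int.add_emod_right]
      exact Int.emod_eq_of_lt (by omega) (by omega)
  unfold Nat.ModEq
  split_ifs at * <;> omega

/-- Let `p > 3` be a prime and `j` an integer with `2 ≤ j ≤ p-1`.  Let `M_p(j)` be the set of
integers `i` with `1 ≤ i ≤ (p-1)/2` such that `i < {ij}_p < p/2`, where `{x}_p` is the least
nonnegative residue of `x` modulo `p`.  Then
`|M_p(j)| ≡ ((1-j | p) - 1)/2 + (p²-1)/8 (mod 2)`. -/
theorem card_M_congr (p : ℕ) [Fact p.Prime] (hp : 3 < p) (j : ℕ)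
    (hj1 : 2 ≤ j) (hj2 : j ≤ p - 1) :
    ((((Finset.Icc 1 ((p - 1) / 2)).filter
        (fun i : ℕ => i < (i * j) % p ∧ 2 * ((i * j) % p) < p)).card : ℤ))
      ≡ (legendreSym p (1 - (j : ℤ)) - 1) / 2 + ((p : ℤ) ^ 2 - 1) / 8 [ZMOD 2] := by
  have hodd : p % 2 = 1 := (Fact.out : p.Prime).eq_two_or_odd.resolve_left (by omega)
  have hj : (j : ZMod p) ≠ 0 := by
    rw [Ne, ZMod.natCast_eq_zero_iff]
    exact Nat.not_dvd_of_pos_of_lt (by omega) (by omega)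
  have hj' : (1 - j : ZMod p) ≠ 0 := by
    rw [← neg_ne_zero, neg_sub, ← Nat.cast_one, ← Nat.cast_sub (by omega), Ne,
      ZMod.natCast_eq_zero_iff]
    exact Nat.not_dvd_of_pos_of_lt (by omega) (by omega)
  have hIcc : Icc 1 ((p - 1) / 2) = Ico 1 (p / 2).succ := by
    ext i
    simp only [mem_Icc, mem_Ico]
    omega
  have hsum : ((p : ℤ) ^ 2 - 1) / 8 = (∑ i ∈ Ico 1 (p / 2).succ, i : ℕ) := by
    have h := eight_mul_sum_Ico_add_one (p / 2)
    rw [show 2 * (p / 2) + 1 = p by omega] at h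
    zify at h ⊢
    omega
  have hcount := Nat.ModEq.sum (s := Ico 1 (p / 2).succ)
    (fun i hi => indicator_add_indicator_modEq p (by omega) j i hi)
  simp only [sum_add_distrib, sum_natAbs_valMinAbs_mul p hj, sum_natAbs_valMinAbs_mul p hj',
    ← card_filter] at hcount
  have hgauss := ZMod.gauss_lemma (p := p) (by omega) (a := 1 - (j : ℤ)) (by push_cast; exact hj')
  push_cast at hgauss
  rw [hIcc, hsum, hgauss]
  generalize #{x ∈ Ico 1 (p / 2).succ | p / 2 < ((1 - j : ZMod p) * x.cast).val} = N at *
  unfold Nat.ModEq at hcount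
  unfold Int.ModEq
  rcases Nat.even_or_odd N with hN | hN
  · rw [hN.neg_one_pow]
    obtain ⟨k, rfl⟩ := hN
    omega
  · rw [hN.neg_one_pow]
    obtain ⟨k, rfl⟩ := hN
    omega
end

section
/- Let p > 3 be a prime and let j be an integer with 2 ≤ j ≤ p−1. Let L_p(j) be the set of integers i with 1 ≤ i ≤ (p−1)/2 such that {i(j−1)}_p < p/2 < {ij}_p. Then |L_p(j)| ≡ (p²−1)/8 (mod 2). -/
open Finset

/-- The parity of the sum of the least residues of the first `(p - 1) / 2` multiples of `k`,
in terms of the number of those residues exceeding `p / 2` that occurs in Gauss's lemma. -/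
theorem sum_mul_mod_eq_sum_add_ite (p : ℕ) [Fact p.Prime] (hp : 2 < p) (k : ℕ) (hk : ¬ p ∣ k) :
    ∑ i ∈ Icc 1 ((p - 1) / 2), ((i * k % p : ℕ) : ZMod 2) =
      ∑ i ∈ Icc 1 ((p - 1) / 2), (i : ZMod 2) +
        ∑ i ∈ Icc 1 ((p - 1) / 2), (if p < 2 * (i * k % p) then 1 else 0 : ZMod 2) := by
  have hodd : p % 2 = 1 :=
    Nat.odd_iff.mp ((Fact.out : p.Prime).odd_of_ne_two (by omega))
  have hIcc : Icc 1 ((p - 1) / 2) = Ico 1 (p / 2).succ := by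
    ext i
    simp only [mem_Icc, mem_Ico]
    omega
  have hk0 : (k : ZMod p) ≠ 0 := by rwa [Ne, ZMod.natCast_eq_zero_iff]
  have hperm : ∑ i ∈ Ico 1 (p / 2).succ, (i : ZMod 2) =
      ∑ i ∈ Ico 1 (p / 2).succ, (((k : ZMod p) * (i : ZMod p)).valMinAbs.natAbs : ZMod 2) := by
    have h := congrArg (fun s : Multiset ℕ => (s.map (Nat.cast : ℕ → ZMod 2)).sum)
      (ZMod.Ico_map_valMinAbs_natAbs_eq_Ico_map_id p (k : ZMod p) hk0)
    simp only [Multiset.map_map] at h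
    exact h.symm
  rw [hIcc, hperm, ← sum_add_distrib]
  refine sum_congr rfl fun i _ => ?_
  have hval : ((k : ZMod p) * (i : ZMod p)).val = i * k % p := by
    rw [← Nat.cast_mul, ZMod.val_natCast, mul_comm]
  have hlt : i * k % p < p := Nat.mod_lt _ (by omega)
  rw [ZMod.valMinAbs_def_pos, hval]
  generalize i * k % p = c at hlt ⊢
  have hite : (if p < 2 * c then 1 else 0 : ZMod 2) =
      ((if p < 2 * c then 1 else 0 : ℕ) : ZMod 2) := by
    split_ifs <;> simp
  rw [hite, ← Nat.cast_add, ZMod.natCast_eq_natCast_iff']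
  split_ifs <;> omega

/-- Let `p > 3` be a prime and `j` an integer with `2 ≤ j ≤ p-1`.  Let `L_p(j)` be the set of
integers `i` with `1 ≤ i ≤ (p-1)/2` such that `{i(j-1)}_p < p/2 < {ij}_p`, where `{x}_p` is the
least nonnegative residue of `x` modulo `p`.  Then `|L_p(j)| ≡ (p²-1)/8 (mod 2)`. -/
theorem card_L_congr (p : ℕ) [Fact p.Prime] (hp : 3 < p) (j : ℕ)
    (hj1 : 2 ≤ j) (hj2 : j ≤ p - 1) :
    ((((Finset.Icc 1 ((p - 1) / 2)).filter
        (fun i : ℕ => 2 * ((i * (j - 1)) % p) < p ∧ p < 2 * ((i * j) % p))).card : ℤ))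
      ≡ ((p : ℤ) ^ 2 - 1) / 8 [ZMOD 2] := by
  have hodd : p % 2 = 1 :=
    Nat.odd_iff.mp ((Fact.out : p.Prime).odd_of_ne_two (by omega))
  have hsum : ((p : ℤ) ^ 2 - 1) / 8 = ((∑ i ∈ Icc 1 ((p - 1) / 2), i : ℕ) : ℤ) := by
    obtain ⟨n, rfl⟩ : ∃ n, p = 2 * n + 1 := ⟨p / 2, by omega⟩
    have hn : (2 * n + 1 - 1) / 2 = n := by omega
    have hgauss : ∀ m : ℕ, 2 * ∑ i ∈ Icc 1 m, i = m * (m + 1) := by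
      intro m
      induction m with
      | zero => simp
      | succ m ih => rw [sum_Icc_succ_top (by omega), mul_add, ih]; ring
    have h : (2 : ℤ) * ((∑ i ∈ Icc 1 n, i : ℕ) : ℤ) = n * (n + 1) := by exact_mod_cast hgauss n
    rw [hn]
    refine Int.ediv_eq_of_eq_mul_right (by norm_num) ?_
    push_cast at h ⊢
    linear_combination -4 * h
  rw [hsum]
  refine (ZMod.intCast_eq_intCast_iff _ _ 2).mp ?_
  have hj : ¬ p ∣ j := Nat.not_dvd_of_pos_of_lt (by omega) (by omega)
  have hj' : ¬ p ∣ j - 1 := Nat.not_dvd_of_pos_of_lt (by omega) (by omega)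
  have hpoint : ∀ i ∈ Icc 1 ((p - 1) / 2),
      (if 2 * (i * (j - 1) % p) < p ∧ p < 2 * (i * j % p) then 1 else 0 : ZMod 2) =
        ((i * j % p : ℕ) : ZMod 2) + (if p < 2 * (i * j % p) then 1 else 0) +
          (((i * (j - 1) % p : ℕ) : ZMod 2) +
            (if p < 2 * (i * (j - 1) % p) then 1 else 0)) + (i : ZMod 2) := by
    intro i hi
    rw [mem_Icc] at hi
    have hstep : i * j % p = (i + i * (j - 1) % p) % p := by
      rw [Nat.add_mod_mod]
      congr 1
      obtain ⟨m, rfl⟩ : ∃ m, j = m + 1 := ⟨j - 1, by omega⟩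
      rw [Nat.add_sub_cancel]
      ring
    have hb : i * (j - 1) % p < p := Nat.mod_lt _ (by omega)
    have hc : i * j % p = i + i * (j - 1) % p ∧ i + i * (j - 1) % p < p ∨
        i * j % p + p = i + i * (j - 1) % p := by
      rcases lt_or_ge (i + i * (j - 1) % p) p with h | h
      · exact Or.inl ⟨by rw [hstep, Nat.mod_eq_of_lt h], h⟩
      · right
        rw [hstep, Nat.mod_eq_sub_mod h, Nat.mod_eq_of_lt (by omega)]
        omega
    have hclt : i * j % p < p := Nat.mod_lt _ (by omega)
    generalize i * (j - 1) % p = b at *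
    generalize i * j % p = c at *
    have hcast : ∀ (P : Prop) [Decidable P],
        (if P then 1 else 0 : ZMod 2) = ((if P then 1 else 0 : ℕ) : ZMod 2) := by
      intro P _
      split_ifs <;> simp
    simp only [hcast, ← Nat.cast_add]
    rw [ZMod.natCast_eq_natCast_iff']
    split_ifs <;> omega
  rw [Int.cast_natCast, Int.cast_natCast, ← sum_boole, sum_congr rfl hpoint]
  simp only [sum_add_distrib]
  rw [sum_mul_mod_eq_sum_add_ite p (by omega) j hj,
    sum_mul_mod_eq_sum_add_ite p (by omega) (j - 1) hj', Nat.cast_sum]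
  have htwo : (2 : ZMod 2) = 0 := rfl
  generalize ∑ i ∈ Icc 1 ((p - 1) / 2), (i : ZMod 2) = s
  linear_combination (s +
    ∑ i ∈ Icc 1 ((p - 1) / 2), (if p < 2 * (i * j % p) then 1 else 0 : ZMod 2) +
    ∑ i ∈ Icc 1 ((p - 1) / 2), (if p < 2 * (i * (j - 1) % p) then 1 else 0 : ZMod 2)) * htwo
end

section
/- Let p > 3 be a prime, write k = ⌊p/8⌋, and let N_p(4) be the number of quadratic nonresidues modulo p among the integers in (p/8, p/4) ∪ (3p/8, p/2). Then (−1)^{N_p(4)} equals 1 if p ≡ 1 (mod 8); equals −1 if p ≡ 5 (mod 8); equals (−1)^k if p ≡ 3 (mod 8); and equals (−1)^{k+1} if p ≡ 7 (mod 8). -/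
open Finset

/-- A power of `-1` counting nonresidues is the product of the Legendre symbols. -/
theorem neg_one_pow_card_filter_legendreSym (p : ℕ) [Fact p.Prime] (s : Finset ℕ)
    (hs : ∀ a ∈ s, ((a : ℤ) : ZMod p) ≠ 0) :
    (-1 : ℤ) ^ (s.filter (fun a : ℕ => legendreSym p a = -1)).card
      = ∏ a ∈ s, legendreSym p a := by
  rw [← Finset.prod_const, Finset.prod_filter]
  refine Finset.prod_congr rfl fun a ha => ?_
  rcases legendreSym.eq_one_or_neg_one p (hs a ha) with h | h <;> simp [h]

theorem intCast_ne_zero_of_pos_of_lt {p a : ℕ} (h0 : 0 < a) (h1 : a < p) :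
    ((a : ℤ) : ZMod p) ≠ 0 := by
  rw [Int.cast_natCast, Ne, ZMod.natCast_eq_zero_iff]
  exact Nat.not_dvd_of_pos_of_lt h0 h1

/-- The even integers in `(0, p/4)` are the doubles of those in `(0, p/8)`. -/
theorem prod_even_legendreSym (p : ℕ) [Fact p.Prime] :
    ∏ a ∈ (Ioc 0 (p / 4)).filter Even, legendreSym p a
      = ∏ a ∈ Ioc 0 (p / 8), legendreSym p 2 * legendreSym p a := by
  symm
  refine Finset.prod_bij (fun a _ => 2 * a) ?_ ?_ ?_ ?_
  · intro a ha
    simp only [mem_filter, mem_Ioc, even_two, Even.mul_right, and_true] at ha ⊢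
    omega
  · intro a _ b _ h
    simpa using h
  · intro b hb
    simp only [mem_filter, mem_Ioc] at hb
    obtain ⟨hb, c, rfl⟩ := hb
    refine ⟨c, ?_, by ring⟩
    simp only [mem_Ioc]
    omega
  · intro a _
    rw [← legendreSym.mul]
    push_cast
    rfl

/-- The odd integers in `(0, p/4)` are the `p - 2a` for `a` in `(3p/8, p/2)`. -/
theorem prod_odd_legendreSym (p : ℕ) [Fact p.Prime] (hodd : p % 2 = 1) :
    ∏ a ∈ (Ioc 0 (p / 4)).filter (fun a => ¬ Even a), legendreSym p a
      = ∏ a ∈ Ioc (3 * p / 8) (p / 2), legendreSym p (-2) * legendreSym p a := by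
  symm
  refine Finset.prod_bij (fun a _ => p - 2 * a) ?_ ?_ ?_ ?_
  · intro a ha
    simp only [mem_filter, mem_Ioc, Nat.even_iff] at ha ⊢
    omega
  · intro a ha b hb h
    simp only [mem_Ioc] at ha hb
    omega
  · intro b hb
    simp only [mem_filter, mem_Ioc, Nat.even_iff] at hb
    refine ⟨(p - b) / 2, ?_, ?_⟩
    · simp only [mem_Ioc]
      omega
    · omega
  · intro a ha
    simp only [mem_Ioc] at ha
    rw [← legendreSym.mul, legendreSym.mod p (-2 * a), legendreSym.mod p ((p - 2 * a : ℕ) : ℤ)]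
    congr 1
    rw [Nat.cast_sub (by omega)]
    push_cast
    rw [sub_eq_add_neg, Int.add_emod_left, neg_mul]

theorem prod_legendreSym_eighths (p : ℕ) [Fact p.Prime] (hodd : p % 2 = 1) :
    (∏ a ∈ Ioc (p / 8) (p / 4), legendreSym p a)
        * ∏ a ∈ Ioc (3 * p / 8) (p / 2), legendreSym p a
      = legendreSym p 2 ^ (p / 8) * legendreSym p (-2) ^ (p / 2 - 3 * p / 8) := by
  have split : (∏ a ∈ Ioc 0 (p / 8), legendreSym p a) * ∏ a ∈ Ioc (p / 8) (p / 4), legendreSym p a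
      = ∏ a ∈ Ioc 0 (p / 4), legendreSym p a := by
    rw [← Finset.prod_union]
    · rw [Ioc_union_Ioc_eq_Ioc (by omega) (by omega)]
    · exact Finset.Ioc_disjoint_Ioc_of_le le_rfl
  rw [← Finset.prod_filter_mul_prod_filter_not (Ioc 0 (p / 4)) Even, prod_even_legendreSym,
    prod_odd_legendreSym p hodd, Finset.prod_mul_distrib, Finset.prod_mul_distrib,
    Finset.prod_const, Finset.prod_const, Nat.card_Ioc, Nat.card_Ioc, Nat.sub_zero] at split
  have hne : (∏ a ∈ Ioc 0 (p / 8), legendreSym p a) ≠ 0 := by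
    refine Finset.prod_ne_zero_iff.mpr fun a ha => ?_
    simp only [mem_Ioc] at ha
    rw [Ne, legendreSym.eq_zero_iff]
    exact intCast_ne_zero_of_pos_of_lt ha.1 (by omega)
  have hsq : (∏ a ∈ Ioc (3 * p / 8) (p / 2), legendreSym p a) ^ 2 = 1 := by
    rw [← Finset.prod_pow]
    refine Finset.prod_eq_one fun a ha => ?_
    simp only [mem_Ioc] at ha
    exact legendreSym.sq_one p (intCast_ne_zero_of_pos_of_lt (by omega) (by omega))
  refine mul_left_cancel₀ hne ?_
  linear_combination (∏ a ∈ Ioc (3 * p / 8) (p / 2), legendreSym p a) * split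
    + (∏ a ∈ Ioc 0 (p / 8), legendreSym p a) * legendreSym p 2 ^ (p / 8)
      * legendreSym p (-2) ^ (p / 2 - 3 * p / 8) * hsq

/-- Let `p > 3` be a prime, `k = ⌊p/8⌋`, and let `N_p(4)` be the number of quadratic
nonresidues modulo `p` among the integers in `(p/8, p/4) ∪ (3p/8, p/2)`.  Then `(-1)^{N_p(4)}`
equals `1` if `p ≡ 1 (mod 8)`; `-1` if `p ≡ 5 (mod 8)`; `(-1)^k` if `p ≡ 3 (mod 8)`; and
`(-1)^{k+1}` if `p ≡ 7 (mod 8)`. -/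
theorem neg_one_pow_N4 (p : ℕ) [Fact p.Prime] (hp : 3 < p) :
    ((-1 : ℤ) ^ ((Finset.Ioo 0 p).filter
        (fun a : ℕ => ((p < 8 * a ∧ 4 * a < p) ∨ (3 * p < 8 * a ∧ 2 * a < p)) ∧
          legendreSym p a = -1)).card)
      = if p % 8 = 1 then 1
        else if p % 8 = 5 then -1
        else if p % 8 = 3 then (-1) ^ (p / 8)
        else (-1) ^ (p / 8 + 1) := by
  have hodd : p % 2 = 1 := (Fact.out : p.Prime).eq_two_or_odd.resolve_left (by omega)
  have h4 : p % 8 = 1 ∨ p % 8 = 3 ∨ p % 8 = 5 ∨ p % 8 = 7 := by omega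
  have hset : (Finset.Ioo 0 p).filter
        (fun a : ℕ => ((p < 8 * a ∧ 4 * a < p) ∨ (3 * p < 8 * a ∧ 2 * a < p)) ∧
          legendreSym p a = -1)
      = (Ioc (p / 8) (p / 4) ∪ Ioc (3 * p / 8) (p / 2)).filter
          (fun a : ℕ => legendreSym p a = -1) := by
    ext a
    simp only [mem_filter, mem_Ioo, mem_union, mem_Ioc, ← and_assoc]
    refine and_congr_left fun _ => ?_
    omega
  have hdisj : Disjoint (Ioc (p / 8) (p / 4)) (Ioc (3 * p / 8) (p / 2)) :=
    Finset.Ioc_disjoint_Ioc_of_le (by omega)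
  rw [hset, neg_one_pow_card_filter_legendreSym, Finset.prod_union hdisj,
    prod_legendreSym_eighths p hodd, legendreSym.at_two (by omega),
    legendreSym.at_neg_two (by omega), ZMod.χ₈_nat_eq_if_mod_eight,
    ZMod.χ₈'_nat_eq_if_mod_eight]
  · rcases h4 with h | h | h | h
    · simp [h, hodd]
    · simp [h, hodd]
    · have e : p / 2 - 3 * p / 8 = p / 8 + 1 := by omega
      simp [h, hodd, e, ← pow_add, ← two_mul, pow_succ]
    · have e : p / 2 - 3 * p / 8 = p / 8 + 1 := by omega
      simp [h, hodd, e]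
  · intro a ha
    simp only [mem_union, mem_Ioc] at ha
    exact intCast_ne_zero_of_pos_of_lt (by omega) (by omega)
end
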